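/- arXiv:2012.02002 — 3 statements merged into one kernel-verified Lean document; each statement's English description precedes it below -/
import Mathlib

section
/- Let n ≥ 1, R > 0, t > 0, and let u₀ : ℝⁿ → ℝ be integrable with u₀ ≥ 0 and support contained in the closed ball of radius R centered at the origin, and let u be the heat extension of u₀. Then there exists a constant C > 0, depending only on n, R and t (and not on u₀), such that ‖u₀‖_{L¹(ℝⁿ)} ≤ C · ( ∫_{‖y‖ < 2R} |u(y,t)|² dy )^{1/2}. -/
open MeasureTheory Real

/-- The heat extension of an initial datum `u₀ : ℝⁿ → ℝ`:
`u(y,t) = (4πt)^(-n/2) ∫ u₀(r) exp(-‖y-r‖²/(4t)) dr`. -/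
noncomputable def heatExt (n : ℕ) (u₀ : EuclideanSpace ℝ (Fin n) → ℝ)
    (y : EuclideanSpace ℝ (Fin n)) (t : ℝ) : ℝ :=
  (4 * π * t) ^ (-(n : ℝ) / 2) * ∫ r, u₀ r * Real.exp (-‖y - r‖ ^ 2 / (4 * t))

/-- For a nonnegative integrable initial temperature supported in the ball of radius `R`,
the `L¹` norm of `u₀` is controlled by the `L²(2B)` norm of its heat extension at any
single positive time `t`. -/
theorem lipschitz_stability_single_time (n : ℕ) (hn : 1 ≤ n) (R t : ℝ)
    (hR : 0 < R) (ht : 0 < t) :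
    ∃ C > 0, ∀ u₀ : EuclideanSpace ℝ (Fin n) → ℝ,
      Integrable u₀ →
      (∀ y, 0 ≤ u₀ y) →
      Function.support u₀ ⊆ Metric.closedBall 0 R →
      (∫ y, |u₀ y|) ≤
        C * (∫ y in Metric.ball (0 : EuclideanSpace ℝ (Fin n)) (2 * R),
              (heatExt n u₀ y t) ^ 2) ^ ((1 : ℝ) / 2) := by
  set K : ℝ := (4 * π * t) ^ (-(n : ℝ) / 2) with hK
  have hKpos : 0 < K := Real.rpow_pos_of_pos (by positivity) _
  set e : ℝ := Real.exp (-(3 * R) ^ 2 / (4 * t)) with he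
  have hepos : 0 < e := Real.exp_pos _
  set V : ℝ := volume.real (Metric.ball (0 : EuclideanSpace ℝ (Fin n)) (2 * R)) with hV
  have hVpos : 0 < V := by
    rw [hV, measureReal_def]
    exact ENNReal.toReal_pos (Metric.measure_ball_pos _ _ (by positivity)).ne'
      measure_ball_lt_top.ne
  have hs : 0 < Real.sqrt V := Real.sqrt_pos.mpr hVpos
  refine ⟨(K * e * Real.sqrt V)⁻¹, by positivity, ?_⟩
  intro u₀ hint hnn hsupp
  have habs : (∫ y, |u₀ y|) = ∫ y, u₀ y := by
    congr 1
    funext y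
    exact abs_of_nonneg (hnn y)
  rw [habs]
  set M : ℝ := ∫ y, u₀ y with hM
  have hM0 : 0 ≤ M := integral_nonneg hnn
  have hexp_le : ∀ y r : EuclideanSpace ℝ (Fin n),
      Real.exp (-‖y - r‖ ^ 2 / (4 * t)) ≤ 1 := by
    intro y r
    apply Real.exp_le_one_iff.mpr
    apply div_nonpos_of_nonpos_of_nonneg
    · have := sq_nonneg ‖y - r‖
      linarith
    · positivity
  have hmeas : ∀ y, AEStronglyMeasurable
      (fun r => u₀ r * Real.exp (-‖y - r‖ ^ 2 / (4 * t))) volume := by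
    intro y
    refine hint.aestronglyMeasurable.mul ?_
    exact Continuous.aestronglyMeasurable (by fun_prop)
  have hbd : ∀ y r, ‖u₀ r * Real.exp (-‖y - r‖ ^ 2 / (4 * t))‖ ≤ u₀ r := by
    intro y r
    rw [Real.norm_of_nonneg (mul_nonneg (hnn r) (Real.exp_pos _).le)]
    exact mul_le_of_le_one_right (hnn r) (hexp_le y r)
  have hint2 : ∀ y, Integrable (fun r => u₀ r * Real.exp (-‖y - r‖ ^ 2 / (4 * t))) := by
    intro y
    exact hint.mono' (hmeas y) (Filter.Eventually.of_forall (hbd y))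
  have hcont : Continuous (fun y => heatExt n u₀ y t) := by
    unfold heatExt
    refine continuous_const.mul ?_
    refine continuous_of_dominated hmeas
      (fun y => Filter.Eventually.of_forall (hbd y)) hint ?_
    refine Filter.Eventually.of_forall fun r => ?_
    fun_prop
  have hlow : ∀ y ∈ Metric.ball (0 : EuclideanSpace ℝ (Fin n)) (2 * R),
      (K * e * M) ^ 2 ≤ (heatExt n u₀ y t) ^ 2 := by
    intro y hy
    refine pow_le_pow_left₀ (by positivity) ?_ 2
    unfold heatExt
    rw [← hK, mul_assoc]
    refine mul_le_mul_of_nonneg_left ?_ hKpos.le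
    rw [hM, mul_comm, ← integral_mul_const]
    refine integral_mono (hint.mul_const _) (hint2 y) ?_
    intro r
    by_cases hr : u₀ r = 0
    · simp [hr]
    · have hr' := hsupp (Function.mem_support.mpr hr)
      rw [mem_closedBall_zero_iff] at hr'
      rw [mem_ball_zero_iff] at hy
      refine mul_le_mul_of_nonneg_left ?_ (hnn r)
      apply Real.exp_le_exp.mpr
      refine div_le_div_of_nonneg_right ?_ (by positivity)
      have h3 : ‖y - r‖ ≤ 3 * R := (norm_sub_le y r).trans (by linarith)
      have := pow_le_pow_left₀ (norm_nonneg _) h3 2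
      linarith
  have hI : IntegrableOn (fun y => (heatExt n u₀ y t) ^ 2)
      (Metric.ball (0 : EuclideanSpace ℝ (Fin n)) (2 * R)) := by
    refine IntegrableOn.mono_set ?_ Metric.ball_subset_closedBall
    exact (hcont.pow 2).continuousOn.integrableOn_compact (isCompact_closedBall _ _)
  have hbig : (K * e * M) ^ 2 * V ≤
      ∫ y in Metric.ball (0 : EuclideanSpace ℝ (Fin n)) (2 * R), (heatExt n u₀ y t) ^ 2 := by
    have h := setIntegral_mono_on (integrableOn_const (C := (K * e * M) ^ 2)
      (hs := measure_ball_lt_top.ne)) hI measurableSet_ball hlow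
    rw [setIntegral_const, smul_eq_mul, mul_comm] at h
    exact h
  rw [← Real.sqrt_eq_rpow]
  have h2 := Real.sqrt_le_sqrt hbig
  rw [Real.sqrt_mul (sq_nonneg _), Real.sqrt_sq (by positivity)] at h2
  rw [inv_mul_eq_div, le_div_iff₀ (by positivity)]
  linarith
end

section
/- Let σ : ℝ → ℝ satisfy the σ-properties for a₁ < a₂, ξ₁, ξ₂ > 0, C₀ > 0. Let 0 < δ < (a₂−a₁)/2 and let u₀ : ℝ → ℝ be integrable with support contained in (a₁+δ, a₂−δ), and let u be the heat extension of u₀ (with n = 1), whose spatial derivative is ∂_y u(y,t) = ∫_{ℝ} u₀(r) · (−(y−r)/(2t)) · (4πt)^(−1/2) exp(−(y−r)²/(4t)) dr for t > 0. Then there exists a constant C > 0, depending only on σ and δ (and not on u₀), such that for all y ∈ (a₁, a₁+ξ₁]: |∂_y u(y, σ(y))| ≤ C · ‖u₀‖_{L¹(ℝ)}. -/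
open MeasureTheory Real

/-- The heat extension of an initial datum `u₀ : ℝ → ℝ` (dimension one):
`u(y,t) = (4πt)^(-1/2) ∫ u₀(r) exp(-(y-r)²/(4t)) dr`. -/
noncomputable def heatExt1 (u₀ : ℝ → ℝ) (y t : ℝ) : ℝ :=
  (4 * π * t) ^ (-(1 : ℝ) / 2) * ∫ r, u₀ r * Real.exp (-(y - r) ^ 2 / (4 * t))

/-- The σ-properties from the paper: `σ` is `C¹`, positive exactly on `(a₁,a₂)`,
strictly increasing on `(a₁, a₁+ξ₁]`, strictly decreasing on `[a₂−ξ₂, a₂)`,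
attains equal values at `a₁+ξ₁` and `a₂−ξ₂`, and `1/|σ'| ≤ C₀ exp(1/σ)` near the
endpoints. -/
structure SigmaProperties (σ : ℝ → ℝ) (a₁ a₂ ξ₁ ξ₂ C₀ : ℝ) : Prop where
  a_lt : a₁ < a₂
  ξ₁_pos : 0 < ξ₁
  ξ₂_pos : 0 < ξ₂
  C₀_pos : 0 < C₀
  contDiff : ContDiff ℝ 1 σ
  pos : ∀ y ∈ Set.Ioo a₁ a₂, 0 < σ y
  zero : ∀ y ∉ Set.Ioo a₁ a₂, σ y = 0
  deriv_pos : ∀ y ∈ Set.Ioc a₁ (a₁ + ξ₁), 0 < deriv σ y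
  deriv_neg : ∀ y ∈ Set.Ico (a₂ - ξ₂) a₂, deriv σ y < 0
  val_eq : σ (a₁ + ξ₁) = σ (a₂ - ξ₂)
  growth_left : ∀ y ∈ Set.Ioc a₁ (a₁ + ξ₁), 1 / deriv σ y ≤ C₀ * Real.exp (1 / σ y)
  growth_right : ∀ y ∈ Set.Ico (a₂ - ξ₂) a₂, 1 / (-(deriv σ y)) ≤ C₀ * Real.exp (1 / σ y)

lemma aux_exp (t d E : ℝ) (ht : 0 < t) (hd : 0 < d) (hE : E ≤ Real.exp (-(d / (4 * t)))) :
    (1 / t) * (1 + 1 / t) * E ≤ 4 / d + 32 / d ^ 2 := by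
  have hz : 0 < d / (4 * t) := by positivity
  set z := d / (4 * t) with hzdef
  have h1 : 1 / t = 4 / d * z := by rw [hzdef]; field_simp
  have hq := Real.quadratic_le_exp_of_nonneg hz.le
  have hp : Real.exp (-z) * Real.exp z = 1 := by rw [← Real.exp_add]; simp
  have he : 0 < Real.exp (-z) := Real.exp_pos _
  have e1 : z * Real.exp (-z) ≤ 1 := by
    rw [← hp, mul_comm]
    exact mul_le_mul_of_nonneg_left (by nlinarith [sq_nonneg z]) he.le
  have e2 : z ^ 2 * Real.exp (-z) ≤ 2 := by
    have : Real.exp (-z) * (z ^ 2 / 2) ≤ Real.exp (-z) * Real.exp z :=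
      mul_le_mul_of_nonneg_left (by nlinarith [sq_nonneg z]) he.le
    rw [hp] at this
    linarith
  have h0 : (1 / t) * (1 + 1 / t) * E ≤ (1 / t) * (1 + 1 / t) * Real.exp (-z) :=
    mul_le_mul_of_nonneg_left hE (by positivity)
  refine h0.trans ?_
  rw [h1]
  calc 4 / d * z * (1 + 4 / d * z) * Real.exp (-z)
      = 4 / d * (z * Real.exp (-z)) + (16 / d ^ 2) * (z ^ 2 * Real.exp (-z)) := by
        field_simp
        try ring
    _ ≤ 4 / d * 1 + (16 / d ^ 2) * 2 := by gcongr
    _ = _ := by ring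

lemma aux_rpow (t : ℝ) (ht : 0 < t) : (4 * π * t) ^ (-(1 : ℝ) / 2) ≤ 1 + 1 / t := by
  have hpi := Real.pi_gt_three
  have h1 : t ≤ 4 * π * t := by nlinarith
  have h2 : (4 * π * t) ^ (-(1 : ℝ) / 2) ≤ t ^ (-(1 : ℝ) / 2) :=
    Real.rpow_le_rpow_of_nonpos ht h1 (by norm_num)
  have ht' : 0 < 1 / t := by positivity
  rcases le_total t 1 with h | h
  · have : t ^ (-(1 : ℝ) / 2) ≤ t ^ (-1 : ℝ) :=
      Real.rpow_le_rpow_of_exponent_ge ht h (by norm_num)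
    rw [Real.rpow_neg_one, ← one_div] at this
    linarith
  · have : t ^ (-(1 : ℝ) / 2) ≤ 1 := Real.rpow_le_one_of_one_le_of_nonpos h (by norm_num)
    linarith

/-- Bound on the spatial derivative of the heat extension along the left part of the
curve: for `y ∈ (a₁, a₁+ξ₁]`, `|∂_y u(y,σ(y))| ≤ C ‖u₀‖_{L¹}` with `C = C(σ,δ)`
independent of `u₀`; here `∂_y u` is given by the explicit convolution formula. -/
theorem curve_spatial_derivative_bound (σ : ℝ → ℝ) (a₁ a₂ ξ₁ ξ₂ C₀ δ : ℝ)
    (hσ : SigmaProperties σ a₁ a₂ ξ₁ ξ₂ C₀)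
    (hδ : 0 < δ) (hδ' : δ < (a₂ - a₁) / 2) :
    ∃ C > 0, ∀ u₀ : ℝ → ℝ,
      Integrable u₀ →
      Function.support u₀ ⊆ Set.Ioo (a₁ + δ) (a₂ - δ) →
      ∀ y ∈ Set.Ioc a₁ (a₁ + ξ₁),
        |∫ r, u₀ r * (-(y - r) / (2 * σ y)) * ((4 * π * σ y) ^ (-(1 : ℝ) / 2)
            * Real.exp (-(y - r) ^ 2 / (4 * σ y)))| ≤ C * ∫ r, |u₀ r| := by
  have hlt : a₁ + ξ₁ < a₂ := by
    by_contra hcon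
    have hcon := not_lt.mp hcon
    have hd := hσ.deriv_pos a₂ ⟨hσ.a_lt, hcon⟩
    have hz : σ a₂ = 0 := hσ.zero a₂ (fun h => lt_irrefl _ h.2)
    have hmin : IsLocalMin σ a₂ := by
      refine Filter.Eventually.of_forall fun x => ?_
      rw [hz]
      by_cases hx : x ∈ Set.Ioo a₁ a₂
      · exact (hσ.pos x hx).le
      · exact (hσ.zero x hx).ge
    rw [hmin.deriv_eq_zero] at hd
    exact lt_irrefl _ hd
  obtain ⟨m, hm, hmb⟩ := (isCompact_Icc (a := a₁ + δ / 2) (b := a₁ + ξ₁)).exists_forall_le'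
    hσ.contDiff.continuous.continuousOn (a := 0)
    (fun b hb => hσ.pos b ⟨by linarith [hb.1], by linarith [hb.2]⟩)
  have hL : 0 < a₂ - a₁ := sub_pos.2 hσ.a_lt
  set L := a₂ - a₁ with hLdef
  set d := (δ / 2) ^ 2 with hddef
  have hd : 0 < d := by positivity
  set M := (1 / m) * (1 + 1 / m) + (4 / d + 32 / d ^ 2) with hM
  have hMpos : 0 < M := by positivity
  refine ⟨L * M, by positivity, ?_⟩
  intro u₀ hu hsupp y hy
  have ht : 0 < σ y := hσ.pos y ⟨hy.1, by linarith [hy.2]⟩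
  rw [← integral_const_mul, ← Real.norm_eq_abs]
  refine norm_integral_le_of_norm_le (hu.abs.const_mul _) (Filter.Eventually.of_forall fun r => ?_)
  by_cases hr : u₀ r = 0
  · simp [hr]
  have hr' := hsupp hr
  have hxL : |y - r| ≤ L := by
    rw [abs_le]; constructor <;> linarith [hr'.1, hr'.2, hy.1, hy.2]
  set t := σ y with htdef
  have hK : (1 / t) * (1 + 1 / t) * Real.exp (-(y - r) ^ 2 / (4 * t)) ≤ M := by
    rcases le_total y (a₁ + δ / 2) with h | h
    · have hx : d ≤ (y - r) ^ 2 := by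
        rw [hddef]; nlinarith [hr'.1]
      have := aux_exp t d (Real.exp (-(y - r) ^ 2 / (4 * t))) ht hd (by
        rw [Real.exp_le_exp, neg_div]
        apply neg_le_neg
        gcongr)
      have h2 : 0 < (1 / m) * (1 + 1 / m) := by positivity
      linarith
    · have hmt : m ≤ t := hmb y ⟨h, hy.2⟩
      have hE : Real.exp (-(y - r) ^ 2 / (4 * t)) ≤ 1 := by
        rw [Real.exp_le_one_iff, neg_div]
        have : 0 ≤ (y - r) ^ 2 / (4 * t) := by positivity
        linarith
      have h2 : 0 < 4 / d + 32 / d ^ 2 := by positivity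
      calc (1 / t) * (1 + 1 / t) * Real.exp (-(y - r) ^ 2 / (4 * t))
          ≤ (1 / m) * (1 + 1 / m) * 1 := by gcongr
        _ ≤ M := by rw [hM]; linarith
  have hE0 : 0 < Real.exp (-(y - r) ^ 2 / (4 * t)) := Real.exp_pos _
  have hR0 : 0 ≤ (4 * π * t) ^ (-(1 : ℝ) / 2) := by positivity
  have hR := aux_rpow t ht
  rw [Real.norm_eq_abs, abs_mul, abs_mul, abs_div, abs_neg, abs_of_pos (show 0 < 2 * t by positivity),
    abs_of_nonneg (mul_nonneg hR0 hE0.le)]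
  calc |u₀ r| * (|y - r| / (2 * t)) * ((4 * π * t) ^ (-(1 : ℝ) / 2)
            * Real.exp (-(y - r) ^ 2 / (4 * t)))
      ≤ |u₀ r| * (L / t) * ((1 + 1 / t) * Real.exp (-(y - r) ^ 2 / (4 * t))) := by
        gcongr
        linarith
    _ = |u₀ r| * L * ((1 / t) * (1 + 1 / t) * Real.exp (-(y - r) ^ 2 / (4 * t))) := by ring
    _ ≤ |u₀ r| * L * M := by gcongr
    _ = L * M * |u₀ r| := by ring
end

section
/- Let s ∈ ℝ, y̲ < ȳ, and let γ : [y̲, ȳ] → ℝ be continuously differentiable with γ(y̲) = s, γ(y) < s for y ∈ (y̲, ȳ], and γ'(y̲) < 0. Let ψ : ℝ² → ℝ be continuously differentiable and suppose there exist constants m > 0 and M ≥ 0 such that ψ(x,y) ≥ m and |∂_y ψ(x,y)| ≤ M for all (x,y) ∈ [min γ, s] × [y̲, ȳ]. Define σ(y) := (1/2) ∫_{γ(y)}^{s} (s−τ)² ψ(τ, y) dτ for y ∈ [y̲, ȳ], so that σ'(y) = −(1/2) γ'(y) (s−γ(y))² ψ(γ(y), y) + (1/2) ∫_{γ(y)}^{s}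 (s−τ)² ∂_y ψ(τ, y) dτ. Then there exists ξ₁ > 0 such that σ'(y) > 0 for all y ∈ (y̲, y̲+ξ₁]. -/
open MeasureTheory Real

/-- Verification of σ-property iii) in the LSFM model: with
`σ'(y) = −(1/2)γ'(y)(s−γ(y))²ψ(γ(y),y) + (1/2)∫_{γ(y)}^{s}(s−τ)² ∂_yψ(τ,y) dτ`,
`γ(y̲) = s`, `γ'(y̲) < 0`, `ψ ≥ m > 0` and `|∂_yψ| ≤ M` on `[min γ, s] × [y̲, ȳ]`,
there exists `ξ₁ > 0` with `σ' > 0` on `(y̲, y̲+ξ₁]`. -/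
theorem sigma_property_iii (s ylo yhi : ℝ) (hy : ylo < yhi)
    (γ γ' : ℝ → ℝ)
    (hγ_deriv : ∀ y ∈ Set.Icc ylo yhi, HasDerivWithinAt γ (γ' y) (Set.Icc ylo yhi) y)
    (hγ'_cont : ContinuousOn γ' (Set.Icc ylo yhi))
    (hγ_lo : γ ylo = s)
    (hγ_lt : ∀ y ∈ Set.Ioc ylo yhi, γ y < s)
    (hγ'_neg : γ' ylo < 0)
    (ψ : ℝ → ℝ → ℝ) (hψ : ContDiff ℝ 1 (Function.uncurry ψ))
    (m M : ℝ) (hm : 0 < m) (hM : 0 ≤ M)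
    (hbounds : ∀ x ∈ Set.Icc (sInf (γ '' Set.Icc ylo yhi)) s, ∀ y ∈ Set.Icc ylo yhi,
      m ≤ ψ x y ∧ |deriv (ψ x) y| ≤ M)
    (σ' : ℝ → ℝ)
    (hσ' : ∀ y ∈ Set.Icc ylo yhi,
      σ' y = -(1 / 2) * γ' y * (s - γ y) ^ 2 * ψ (γ y) y
        + (1 / 2) * ∫ τ in (γ y)..s, (s - τ) ^ 2 * deriv (ψ τ) y) :
    ∃ ξ₁ > 0, ylo + ξ₁ ≤ yhi ∧ ∀ y ∈ Set.Ioc ylo (ylo + ξ₁), 0 < σ' y := by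
  have hγc : ContinuousOn γ (Set.Icc ylo yhi) := fun y h => (hγ_deriv y h).continuousWithinAt
  have hlo : ylo ∈ Set.Icc ylo yhi := ⟨le_rfl, hy.le⟩
  have hg : ContinuousOn (fun y => -γ' y * m - M * (s - γ y)) (Set.Icc ylo yhi) := by
    fun_prop
  have hg0 : 0 < -γ' ylo * m - M * (s - γ ylo) := by
    rw [hγ_lo]
    have := mul_pos (neg_pos.2 hγ'_neg) hm
    linarith
  have hev := (hg ylo hlo).eventually (lt_mem_nhds hg0)
  rw [eventually_nhdsWithin_iff, Metric.eventually_nhds_iff] at hev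
  obtain ⟨ε, hε, hev⟩ := hev
  refine ⟨min (ε / 2) (yhi - ylo), lt_min (by linarith) (by linarith), ?_, ?_⟩
  · linarith [min_le_right (ε / 2) (yhi - ylo)]
  rintro y ⟨hy1, hy2⟩
  have h1 := min_le_left (ε / 2) (yhi - ylo)
  have h2 := min_le_right (ε / 2) (yhi - ylo)
  have hyI : y ∈ Set.Icc ylo yhi := ⟨hy1.le, by linarith⟩
  have hgy : 0 < -γ' y * m - M * (s - γ y) := by
    refine hev ?_ hyI
    rw [Real.dist_eq, abs_of_pos (by linarith)]
    linarith
  have hlt : γ y < s := hγ_lt y ⟨hy1, hyI.2⟩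
  have hd : 0 < s - γ y := by linarith
  have hinf : sInf (γ '' Set.Icc ylo yhi) ≤ γ y :=
    csInf_le (isCompact_Icc.image_of_continuousOn hγc).bddBelow ⟨y, hyI, rfl⟩
  have hψy : m ≤ ψ (γ y) y := (hbounds (γ y) ⟨hinf, hlt.le⟩ y hyI).1
  have hint : |∫ τ in (γ y)..s, (s - τ) ^ 2 * deriv (ψ τ) y|
      ≤ (s - γ y) ^ 2 * M * |s - γ y| := by
    rw [← Real.norm_eq_abs]
    refine intervalIntegral.norm_integral_le_of_norm_le_const ?_
    intro τ hτ
    rw [Set.uIoc_of_le hlt.le] at hτ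
    have hb := (hbounds τ ⟨hinf.trans hτ.1.le, hτ.2⟩ y hyI).2
    rw [Real.norm_eq_abs, abs_mul, abs_of_nonneg (sq_nonneg (s - τ))]
    have h3 : (s - τ) ^ 2 ≤ (s - γ y) ^ 2 :=
      pow_le_pow_left₀ (by linarith [hτ.2]) (by linarith [hτ.1]) 2
    exact mul_le_mul h3 hb (abs_nonneg _) (sq_nonneg _)
  rw [abs_of_pos hd] at hint
  have hint' := (abs_le.1 hint).1
  have hγn : 0 ≤ -γ' y := by
    by_contra hcon
    nlinarith [mul_nonneg hM hd.le, mul_pos (neg_pos.2 (not_le.1 hcon)) hm]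
  have h4 : -γ' y * m ≤ -γ' y * ψ (γ y) y := mul_le_mul_of_nonneg_left hψy hγn
  have h5 : 0 < (s - γ y) ^ 2 * (-γ' y * ψ (γ y) y - M * (s - γ y)) :=
    mul_pos (pow_pos hd 2) (by linarith)
  rw [hσ' y hyI]
  linarith
end
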